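/- Let n ≥ 2 with n ≡ 3 (mod 4), and let γ_i = !![0, 1; −1, 0]. Consider on X_n = {γ ∈ SL₂(ℤ) : ν(γ) = n} the equivalence relation γ ~ γ' iff γ' = γ_i^{j₁} γ γ_i^{j₂} for some integers j₁, j₂. Then every equivalence class contains exactly one element γ for which both z₁(γ) and z₂(γ) are primary, and the resulting map from the set of equivalence classes X_n/~ to C_n = {z₁ ∈ ℤ[i] primary : N(z₁) = n+2} × {z₂ ∈ ℤ[i] primary : N(z₂) = n−2}, sending a class to (z₁(γ), z₂(γ)) for this distinguished representative γ, is a bijection. -/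

import Mathlib

open Matrix Complex

noncomputable section

/-- `SL₂(ℤ)`, the group of 2×2 integer matrices of determinant 1. -/
abbrev SL2Z := Matrix.SpecialLinearGroup (Fin 2) ℤ

/-- `ν(γ) = a² + b² + c² + d²`. -/
def nuH (γ : SL2Z) : ℤ := (γ.1 0 0) ^ 2 + (γ.1 0 1) ^ 2 + (γ.1 1 0) ^ 2 + (γ.1 1 1) ^ 2

/-- `z₁(γ) = (a + d) + (b - c)i ∈ ℤ[i]`. -/
def z1 (γ : SL2Z) : GaussianInt := ⟨γ.1 0 0 + γ.1 1 1, γ.1 0 1 - γ.1 1 0⟩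

/-- `z₂(γ) = (a - d) - (b + c)i ∈ ℤ[i]`. -/
def z2 (γ : SL2Z) : GaussianInt := ⟨γ.1 0 0 - γ.1 1 1, -(γ.1 0 1 + γ.1 1 0)⟩

/-- The elliptic element `γ_i = !![0, 1; -1, 0] ∈ SL₂(ℤ)`. -/
def gammaI : SL2Z := ⟨!![0, 1; -1, 0], by norm_num [Matrix.det_fin_two_of]⟩

/-- A Gaussian integer is primary if it is ≡ 1 mod (1+i)³. -/
def Primary (z : GaussianInt) : Prop := ((⟨1, 1⟩ : GaussianInt)) ^ 3 ∣ (z - 1)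

theorem primary_iff (z : GaussianInt) :
    Primary z ↔ z.im % 2 = 0 ∧ (z.re + z.im) % 4 = 1 := by
  have h3 : (⟨1, 1⟩ : GaussianInt) ^ 3 = ⟨-2, 2⟩ := by decide
  unfold Primary
  rw [h3]
  constructor
  · rintro ⟨w, hw⟩
    have hre := congrArg Zsqrtd.re hw
    have him := congrArg Zsqrtd.im hw
    simp at hre him
    omega
  · rintro ⟨h1, h2⟩
    refine ⟨⟨(z.im - (z.re - 1)) / 4, -((z.re - 1 + z.im) / 4)⟩, ?_⟩
    ext <;> simp <;> omega

theorem gammaI_zpow_cases (j : ℤ) :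
    gammaI ^ j = 1 ∨ gammaI ^ j = gammaI ∨ gammaI ^ j = -1 ∨ gammaI ^ j = -gammaI := by
  have hsq : gammaI ^ (2 : ℤ) = -1 := by decide
  have h4 : gammaI ^ (4 : ℤ) = 1 := by decide
  have hmod : gammaI ^ j = gammaI ^ (j % 4) := by
    conv_lhs => rw [← Int.emod_add_mul_ediv j 4]
    rw [_root_.zpow_add, _root_.zpow_mul, h4, _root_.one_zpow, mul_one]
  have hr : j % 4 = 0 ∨ j % 4 = 1 ∨ j % 4 = 2 ∨ j % 4 = 3 := by omega
  rw [hmod]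
  rcases hr with hr | hr | hr | hr <;> rw [hr]
  · simp
  · simp
  · simp [hsq]
  · right; right; right
    decide

theorem val_gammaI_mul (γ : SL2Z) :
    (gammaI * γ).1 = !![γ.1 1 0, γ.1 1 1; -γ.1 0 0, -γ.1 0 1] := by
  change gammaI.1 * γ.1 = _
  ext i j
  fin_cases i <;> fin_cases j <;> simp [gammaI, Matrix.mul_apply, Fin.sum_univ_two]

theorem val_mul_gammaI (γ : SL2Z) :
    (γ * gammaI).1 = !![-γ.1 0 1, γ.1 0 0; -γ.1 1 1, γ.1 1 0] := by
  change γ.1 * gammaI.1 = _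
  ext i j
  fin_cases i <;> fin_cases j <;> simp [gammaI, Matrix.mul_apply, Fin.sum_univ_two]

theorem z1_gammaI_mul (γ : SL2Z) : z1 (gammaI * γ) = ⟨-(z1 γ).im, (z1 γ).re⟩ := by
  simp only [z1, val_gammaI_mul]
  ext <;> simp <;> ring

theorem z2_gammaI_mul (γ : SL2Z) : z2 (gammaI * γ) = ⟨-(z2 γ).im, (z2 γ).re⟩ := by
  simp only [z2, val_gammaI_mul]
  ext <;> simp <;> ring

theorem z1_mul_gammaI (γ : SL2Z) : z1 (γ * gammaI) = ⟨-(z1 γ).im, (z1 γ).re⟩ := by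
  simp only [z1, val_mul_gammaI]
  ext <;> simp <;> ring

theorem z2_mul_gammaI (γ : SL2Z) : z2 (γ * gammaI) = ⟨(z2 γ).im, -(z2 γ).re⟩ := by
  simp only [z2, val_mul_gammaI]
  ext <;> simp <;> ring

theorem z1_neg (γ : SL2Z) : z1 (-γ) = -z1 γ := by
  ext <;> simp [z1] <;> ring

theorem z2_neg (γ : SL2Z) : z2 (-γ) = -z2 γ := by
  ext <;> simp [z2] <;> ring

theorem norm_z1 (γ : SL2Z) : (z1 γ).norm = nuH γ + 2 := by
  have hdet := γ.det_coe
  rw [Matrix.det_fin_two] at hdet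
  simp only [Zsqrtd.norm_def, z1, nuH]
  linear_combination 2 * hdet

theorem norm_z2 (γ : SL2Z) : (z2 γ).norm = nuH γ - 2 := by
  have hdet := γ.det_coe
  rw [Matrix.det_fin_two] at hdet
  simp only [Zsqrtd.norm_def, z2, nuH]
  linear_combination -2 * hdet

theorem eq_of_z1_eq_of_z2_eq {γ γ' : SL2Z} (h₁ : z1 γ = z1 γ') (h₂ : z2 γ = z2 γ') :
    γ = γ' := by
  simp only [z1, z2, Zsqrtd.ext_iff] at h₁ h₂
  ext i j
  fin_cases i <;> fin_cases j <;> simp <;> omega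

theorem eq_of_primary {γ γ' : SL2Z} (hrel : ∃ j₁ j₂ : ℤ, γ' = gammaI ^ j₁ * γ * gammaI ^ j₂)
    (h₁ : Primary (z1 γ)) (h₂ : Primary (z2 γ))
    (h₁' : Primary (z1 γ')) (h₂' : Primary (z2 γ')) : γ' = γ := by
  obtain ⟨j₁, j₂, rfl⟩ := hrel
  rw [primary_iff] at h₁ h₂ h₁' h₂'
  apply eq_of_z1_eq_of_z2_eq <;>
  rcases gammaI_zpow_cases j₁ with e₁ | e₁ | e₁ | e₁ <;>
  rcases gammaI_zpow_cases j₂ with e₂ | e₂ | e₂ | e₂ <;>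
  rw [e₁, e₂] at h₁' h₂' ⊢ <;>
  simp only [one_mul, mul_one, neg_mul, mul_neg, neg_neg, z1_neg, z2_neg, z1_mul_gammaI,
    z2_mul_gammaI, z1_gammaI_mul, z2_gammaI_mul, Zsqrtd.re_neg, Zsqrtd.im_neg] at h₁' h₂' ⊢ <;>
  omega

theorem odd_re_add_im_of_odd_norm {z : GaussianInt} (h : Odd z.norm) : Odd (z.re + z.im) := by
  have hnorm : z.norm = z.re * z.re + z.im * z.im := by simp [Zsqrtd.norm_def]
  rw [hnorm] at h
  simpa [Int.odd_add, Int.odd_mul, Int.even_mul] using h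

theorem exists_primary {γ : SL2Z} (h : Odd (nuH γ)) :
    ∃ γ' : SL2Z, (∃ j₁ j₂ : ℤ, γ' = gammaI ^ j₁ * γ * gammaI ^ j₂) ∧
      Primary (z1 γ') ∧ Primary (z2 γ') := by
  have hz₁ : Odd ((z1 γ).re + (z1 γ).im) := by
    apply odd_re_add_im_of_odd_norm
    rw [norm_z1]
    exact h.add_even even_two
  have hz₂ : Odd ((z2 γ).re + (z2 γ).im) := by
    apply odd_re_add_im_of_odd_norm
    rw [norm_z2]
    exact h.sub_even even_two
  have hpar : ((z2 γ).re - (z1 γ).re) % 2 = 0 := by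
    simp only [z1, z2]
    omega
  rw [Int.odd_iff] at hz₁ hz₂
  have key : ∀ j₁ j₂ : ℤ, Primary (z1 (gammaI ^ j₁ * γ * gammaI ^ j₂)) ∧
      Primary (z2 (gammaI ^ j₁ * γ * gammaI ^ j₂)) →
      ∃ γ' : SL2Z, (∃ j₁ j₂ : ℤ, γ' = gammaI ^ j₁ * γ * gammaI ^ j₂) ∧
        Primary (z1 γ') ∧ Primary (z2 γ') :=
    fun j₁ j₂ hp => ⟨_, ⟨j₁, j₂, rfl⟩, hp⟩
  have hinv : gammaI⁻¹ = -gammaI := by decide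
  have hsq : gammaI ^ (2 : ℤ) = -1 := by decide
  have hcases : ∀ a : ℤ, a % 2 = 1 → a % 4 = 1 ∨ a % 4 = 3 := by omega
  rcases Int.emod_two_eq_zero_or_one (z1 γ).im with him | him
  · rcases hcases _ hz₁ with h₁ | h₁ <;> rcases hcases _ hz₂ with h₂ | h₂
    on_goal 1 => apply key 0 0
    on_goal 2 => apply key 1 (-1)
    on_goal 3 => apply key 1 1
    on_goal 4 => apply key 2 0
    all_goals
      simp only [_root_.zpow_zero, _root_.zpow_one, _root_.zpow_neg_one, hinv, hsq, one_mul,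
        mul_one, neg_mul, mul_neg, z1_neg, z2_neg, z1_mul_gammaI, z2_mul_gammaI,
        z1_gammaI_mul, z2_gammaI_mul, primary_iff, Zsqrtd.re_neg, Zsqrtd.im_neg]
      omega
  · rcases hcases ((z1 γ).re - (z1 γ).im) (by omega) with h₁ | h₁ <;>
      rcases hcases ((z2 γ).re - (z2 γ).im) (by omega) with h₂ | h₂
    on_goal 1 => apply key 1 0
    on_goal 2 => apply key 0 1
    on_goal 3 => apply key 0 (-1)
    on_goal 4 => apply key (-1) 0
    all_goals
      simp only [_root_.zpow_zero, _root_.zpow_one, _root_.zpow_neg_one, hinv, one_mul, mul_one,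
        neg_mul, mul_neg, z1_neg, z2_neg, z1_mul_gammaI, z2_mul_gammaI, z1_gammaI_mul,
        z2_gammaI_mul, primary_iff, Zsqrtd.re_neg, Zsqrtd.im_neg]
      omega

theorem exists_of_norm_eq {n : ℤ} {z w : GaussianInt} (hz : z.norm = n + 2) (hw : w.norm = n - 2)
    (hre : (z.re - w.re) % 2 = 0) (him : (z.im - w.im) % 2 = 0) :
    ∃ γ : SL2Z, nuH γ = n ∧ z1 γ = z ∧ z2 γ = w := by
  obtain ⟨x, y⟩ := z
  obtain ⟨u, v⟩ := w
  simp only at hre him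
  obtain ⟨s, hs⟩ := Int.dvd_of_emod_eq_zero hre
  obtain ⟨t, ht⟩ := Int.dvd_of_emod_eq_zero him
  obtain rfl : x = u + 2 * s := by omega
  obtain rfl : y = v + 2 * t := by omega
  simp only [Zsqrtd.norm_def] at hz hw
  have hdet : (!![u + s, t; -(v + t), s] : Matrix (Fin 2) (Fin 2) ℤ).det = 1 := by
    rw [Matrix.det_fin_two_of]
    linarith
  refine ⟨⟨_, hdet⟩, ?_, ?_, ?_⟩
  · simp [nuH]
    linarith
  · ext <;> simp [z1] <;> ring
  · ext <;> simp [z2]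

/-- For n ≥ 2 with n ≡ 3 (mod 4): every class of the relation
γ ~ γ_i^{j₁} γ γ_i^{j₂} on {γ : ν(γ) = n} contains a unique element with both
z₁, z₂ primary, and these distinguished representatives biject with C_n. -/
theorem stmt3 (n : ℤ) (h2 : 2 ≤ n) (h : n % 4 = 3) :
    (∀ γ : SL2Z, nuH γ = n →
      ∃! γ' : SL2Z, (∃ j₁ j₂ : ℤ, γ' = gammaI ^ j₁ * γ * gammaI ^ j₂) ∧
        Primary (z1 γ') ∧ Primary (z2 γ')) ∧
    Set.BijOn (fun γ : SL2Z => (z1 γ, z2 γ))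
      {γ : SL2Z | nuH γ = n ∧ Primary (z1 γ) ∧ Primary (z2 γ)}
      {p : GaussianInt × GaussianInt |
        (p.1.norm = n + 2 ∧ Primary p.1) ∧ (p.2.norm = n - 2 ∧ Primary p.2)} := by
  refine ⟨fun γ hγ => ?_, ?_, ?_, ?_⟩
  · obtain ⟨γ', ⟨j₁, j₂, hj⟩, hp₁, hp₂⟩ :=
      exists_primary (γ := γ) (by rw [hγ, Int.odd_iff]; omega)
    refine ⟨γ', ⟨⟨j₁, j₂, hj⟩, hp₁, hp₂⟩, ?_⟩
    rintro γ'' ⟨⟨k₁, k₂, hk⟩, hq₁, hq₂⟩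
    refine eq_of_primary ⟨k₁ - j₁, k₂ - j₂, ?_⟩ hp₁ hp₂ hq₁ hq₂
    rw [hk, hj, sub_eq_add_neg k₂, add_comm k₂, _root_.zpow_add, _root_.zpow_sub, _root_.zpow_neg]
    group
  · rintro γ ⟨hγ, hp₁, hp₂⟩
    exact ⟨⟨by rw [norm_z1, hγ], hp₁⟩, by rw [norm_z2, hγ], hp₂⟩
  · intro γ _ γ' _ heq
    rw [Prod.mk.injEq] at heq
    exact eq_of_z1_eq_of_z2_eq heq.1 heq.2
  · rintro ⟨z, w⟩ ⟨⟨hz, hpz⟩, hw, hpw⟩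
    have hpz' := (primary_iff z).1 hpz
    have hpw' := (primary_iff w).1 hpw
    obtain ⟨γ, hγ, rfl, rfl⟩ :=
      exists_of_norm_eq (z := z) (w := w) hz hw (by omega) (by omega)
    exact ⟨γ, ⟨hγ, hpz, hpw⟩, rfl⟩

end
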